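/- Chain rule for directed information as sum of conditional relative entropies: for a joint measure μ ⊗ Q⃗ on X_{0,n} × Y_{0,n} built from source kernels p_i(dx_i; x^{i-1}) and reproduction kernels q_i(dy_i; y^{i-1}, x^i), the directed information D(μ_{0,n} ⊗ Q⃗_{0,n} ‖ μ_{0,n} × ν_{0,n}) equals Σ_{i=0}^n E[ D( q_i(·; Y^{i-1}, X^i) ‖ ν_i(·; Y^{i-1}) ) ], where ν_i(·; y^{i-1}) is the conditional distribution of Y_i given Y^{i-1} under the joint law and ν_{0,n} is the Y-marginal. -/

import Mathlib

open MeasureTheory ProbabilityTheory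
open scoped ENNReal

section

variable {Ω E F : Type*} [MeasurableSpace Ω] [MeasurableSpace E] [MeasurableSpace F]

-- Relative entropy (Kullback–Leibler divergence), valued in `[0,∞]`.
open Classical in
noncomputable def klDiv {Z : Type*} [MeasurableSpace Z] (P Q : Measure Z) : ℝ≥0∞ :=
  if P ≪ Q ∧ Integrable (llr P Q) P then ENNReal.ofReal (∫ z, llr P Q z ∂P) else ⊤

/-- The vector `X^i = (X_0, ..., X_i)` of past-and-present symbols. -/
abbrev pastPresent (X : ℕ → Ω → E) (i : ℕ) : Ω → (Fin (i + 1) → E) :=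
  fun ω j => X j ω

/-- The vector `Y^{i-1} = (Y_0, ..., Y_{i-1})` of strictly past symbols. -/
abbrev strictPast (Y : ℕ → Ω → F) (i : ℕ) : Ω → (Fin i → F) :=
  fun ω j => Y j ω

/-- The vector `(X_{i+1}, ..., X_n)` of future source symbols. -/
abbrev future (X : ℕ → Ω → E) (i n : ℕ) : Ω → (Fin (n - i) → E) :=
  fun ω j => X (i + 1 + j) ω

lemma klDiv_eq_informationTheory_klDiv {Z : Type*} [MeasurableSpace Z] (P Q : Measure Z)
    [IsProbabilityMeasure P] [IsProbabilityMeasure Q] :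
    klDiv P Q = InformationTheory.klDiv P Q := by
  classical
  rw [klDiv, InformationTheory.klDiv_def]
  simp

namespace InformationTheory

lemma klDiv_map_eq_of_leftInverse {S T : Type*} [MeasurableSpace S] [MeasurableSpace T]
    (P Q : Measure S) [IsFiniteMeasure P] [IsFiniteMeasure Q] {g : S → T} {h : T → S}
    (hg : Measurable g) (hh : Measurable h) (hgh : Function.LeftInverse h g) :
    InformationTheory.klDiv (P.map g) (Q.map g) = InformationTheory.klDiv P Q := by
  refine le_antisymm (klDiv_map_le P Q hg) ?_
  have := klDiv_map_le (P.map g) (Q.map g) hh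
  rwa [Measure.map_map hh hg, Measure.map_map hh hg, hgh.comp_eq_id, Measure.map_id,
    Measure.map_id] at this

variable {S T : Type*} [MeasurableSpace S] [MeasurableSpace T]
  [MeasurableSpace.CountableOrCountablyGenerated S T]

lemma klDiv_kernel_eq (κ η : Kernel S T) [IsFiniteKernel κ] [IsFiniteKernel η] (s : S)
    (hs : κ s ≪ η s) :
    InformationTheory.klDiv (κ s) (η s)
      = ∫⁻ t, ENNReal.ofReal (klFun (κ.rnDeriv η s t).toReal) ∂(η s) := by
  rw [klDiv_eq_lintegral_klFun_of_ac hs]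
  refine lintegral_congr_ae ?_
  filter_upwards [Kernel.rnDeriv_eq_rnDeriv_measure (κ := κ) (η := η) (a := s)] with t ht
  rw [ht]

lemma measurable_klDiv_kernel (κ η : Kernel S T) [IsFiniteKernel κ] [IsFiniteKernel η] :
    Measurable fun s ↦ InformationTheory.klDiv (κ s) (η s) := by
  classical
  have h_eq : (fun s ↦ InformationTheory.klDiv (κ s) (η s)) = fun s ↦
      if κ s ≪ η s then ∫⁻ t, ENNReal.ofReal (klFun (κ.rnDeriv η s t).toReal) ∂(η s) else ∞ := by
    ext s
    split_ifs with hs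
    · exact klDiv_kernel_eq κ η s hs
    · exact klDiv_of_not_ac hs
  rw [h_eq]
  refine Measurable.ite (Kernel.measurableSet_absolutelyContinuous κ η) ?_ measurable_const
  refine Measurable.lintegral_kernel_prod_right ?_
  exact (measurable_klFun.comp (Kernel.measurable_rnDeriv κ η).ennreal_toReal).ennreal_ofReal

lemma klDiv_compProd_right_eq_lintegral (P : Measure S) [IsFiniteMeasure P] (κ η : Kernel S T)
    [IsFiniteKernel κ] [IsFiniteKernel η] :
    InformationTheory.klDiv (P ⊗ₘ κ) (P ⊗ₘ η) = ∫⁻ s, InformationTheory.klDiv (κ s) (η s) ∂P := by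
  by_cases h_ac : ∀ᵐ s ∂P, κ s ≪ η s
  swap
  · rw [klDiv_of_not_ac (by rwa [Measure.absolutelyContinuous_compProd_right_iff])]
    by_contra h_ne
    refine h_ac ?_
    filter_upwards [ae_lt_top (measurable_klDiv_kernel κ η) (Ne.symm h_ne)] with s hs
    by_contra h
    exact hs.ne (klDiv_of_not_ac h)
  have h_meas : Measurable (Function.uncurry (κ.rnDeriv η)) := Kernel.measurable_rnDeriv κ η
  have h_dens : P ⊗ₘ κ = (P ⊗ₘ η).withDensity (Function.uncurry (κ.rnDeriv η)) := by
    have h := Measure.compProd_withDensity (μ := P) (κ := η) h_meas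
    rw [Measure.compProd_congr (η := κ)] at h
    · exact h
    · filter_upwards [h_ac] with s hs using Kernel.withDensity_rnDeriv_eq hs
  rw [klDiv_eq_lintegral_klFun_of_ac (Measure.absolutelyContinuous_compProd_right_iff.2 h_ac)]
  have h_rn : (P ⊗ₘ κ).rnDeriv (P ⊗ₘ η) =ᵐ[P ⊗ₘ η] Function.uncurry (κ.rnDeriv η) := by
    rw [h_dens]
    exact Measure.rnDeriv_withDensity _ h_meas
  calc ∫⁻ p, ENNReal.ofReal (klFun ((P ⊗ₘ κ).rnDeriv (P ⊗ₘ η) p).toReal) ∂(P ⊗ₘ η)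
      = ∫⁻ p, ENNReal.ofReal (klFun (κ.rnDeriv η p.1 p.2).toReal) ∂(P ⊗ₘ η) := by
        refine lintegral_congr_ae ?_
        filter_upwards [h_rn] with p hp
        rw [hp, Function.uncurry]
    _ = ∫⁻ s, ∫⁻ t, ENNReal.ofReal (klFun (κ.rnDeriv η s t).toReal) ∂(η s) ∂P :=
        Measure.lintegral_compProd
          (measurable_klFun.comp h_meas.ennreal_toReal).ennreal_ofReal
    _ = ∫⁻ s, InformationTheory.klDiv (κ s) (η s) ∂P := by
        refine lintegral_congr_ae ?_
        filter_upwards [h_ac] with s hs using (klDiv_kernel_eq κ η s hs).symm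

end InformationTheory

lemma map_prodAssoc_prod_compProd {S T U : Type*} [MeasurableSpace S] [MeasurableSpace T]
    [MeasurableSpace U] (P : Measure S) (R : Measure T) [SFinite P] [SFinite R]
    (η : Kernel T U) [IsSFiniteKernel η] :
    ((P.prod R) ⊗ₘ (η.comap Prod.snd measurable_snd)).map MeasurableEquiv.prodAssoc
      = P.prod (R ⊗ₘ η) := by
  refine Measure.ext_of_lintegral _ fun f hf ↦ ?_
  rw [lintegral_map hf (by fun_prop), Measure.lintegral_compProd (by fun_prop),
    lintegral_prod _ hf.aemeasurable, lintegral_prod]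
  · refine lintegral_congr fun s ↦ ?_
    rw [Measure.lintegral_compProd (by fun_prop)]
    simp [MeasurableEquiv.prodAssoc]
  · refine Measurable.aemeasurable ?_
    exact Measurable.lintegral_kernel_prod_right (κ := η.comap Prod.snd measurable_snd)
      (f := fun a b ↦ f (MeasurableEquiv.prodAssoc (a, b)))
      (hf.comp MeasurableEquiv.prodAssoc.measurable)

/-- Chain rule for the mutual information between `A` and `(B, C)`. -/
lemma klDiv_map_prod_add {S T U : Type*} [MeasurableSpace S] [MeasurableSpace T]
    [MeasurableSpace U] [StandardBorelSpace U] [Nonempty U]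
    (μ : Measure Ω) [IsProbabilityMeasure μ] {A : Ω → S} {B : Ω → T} {C : Ω → U}
    (hA : Measurable A) (hB : Measurable B) (hC : Measurable C)
    (κ : Kernel (S × T) U) [IsMarkovKernel κ]
    (hκ : μ.map (fun ω ↦ (A ω, B ω)) ⊗ₘ κ = μ.map (fun ω ↦ ((A ω, B ω), C ω))) :
    InformationTheory.klDiv (μ.map (fun ω ↦ (A ω, (B ω, C ω))))
        ((μ.map A).prod (μ.map (fun ω ↦ (B ω, C ω))))
      = InformationTheory.klDiv (μ.map (fun ω ↦ (A ω, B ω))) ((μ.map A).prod (μ.map B))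
        + ∫⁻ ω, InformationTheory.klDiv (κ (A ω, B ω)) (condDistrib C B μ (B ω)) ∂μ := by
  have : IsProbabilityMeasure (μ.map A) := Measure.isProbabilityMeasure_map hA.aemeasurable
  have : IsProbabilityMeasure (μ.map B) := Measure.isProbabilityMeasure_map hB.aemeasurable
  have : IsProbabilityMeasure (μ.map (fun ω ↦ (A ω, B ω))) :=
    Measure.isProbabilityMeasure_map (by fun_prop)
  let η : Kernel (S × T) U := (condDistrib C B μ).comap Prod.snd measurable_snd
  have h_joint : μ.map (fun ω ↦ (A ω, (B ω, C ω)))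
      = (μ.map (fun ω ↦ (A ω, B ω)) ⊗ₘ κ).map MeasurableEquiv.prodAssoc := by
    rw [hκ, Measure.map_map (by fun_prop) (by fun_prop)]
    rfl
  have h_prod : (μ.map A).prod (μ.map (fun ω ↦ (B ω, C ω)))
      = (((μ.map A).prod (μ.map B)) ⊗ₘ η).map MeasurableEquiv.prodAssoc := by
    rw [map_prodAssoc_prod_compProd, compProd_map_condDistrib hC.aemeasurable]
  rw [h_joint, h_prod, InformationTheory.klDiv_map_eq_of_leftInverse _ _
    MeasurableEquiv.prodAssoc.measurable MeasurableEquiv.prodAssoc.symm.measurable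
    MeasurableEquiv.prodAssoc.left_inv, InformationTheory.klDiv_compProd_eq_add,
    InformationTheory.klDiv_compProd_right_eq_lintegral,
    lintegral_map (InformationTheory.measurable_klDiv_kernel κ η) (by fun_prop)]
  rfl

lemma compProd_comap_map {S T U : Type*} [MeasurableSpace S] [MeasurableSpace T]
    [MeasurableSpace U] (P : Measure S) [SFinite P] {φ : S → T} (hφ : Measurable φ)
    (κ : Kernel T U) [IsSFiniteKernel κ] :
    (P ⊗ₘ κ.comap φ hφ).map (Prod.map φ id) = P.map φ ⊗ₘ κ := by
  refine Measure.ext_of_lintegral _ fun f hf ↦ ?_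
  rw [lintegral_map hf (by fun_prop), Measure.lintegral_compProd (by fun_prop),
    Measure.lintegral_compProd hf, lintegral_map hf.lintegral_kernel_prod_right' hφ]
  rfl

/-- If `C` is conditionally independent of `D` given `B`, and `A = φ (B, D)` determines `B = π A`,
then the conditional law of `C` given `A` is that of `C` given `B`. -/
lemma compProd_condDistrib_comap_of_condIndepFun {S T U V : Type*} [MeasurableSpace S]
    [MeasurableSpace T] [MeasurableSpace U] [MeasurableSpace V]
    [StandardBorelSpace Ω] [StandardBorelSpace U] [Nonempty U] [StandardBorelSpace V] [Nonempty V]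
    (μ : Measure Ω) [IsProbabilityMeasure μ] {B : Ω → T} {C : Ω → U} {D : Ω → V}
    (hB : Measurable B) (hC : Measurable C) (hD : Measurable D)
    (h_indep : CondIndepFun (MeasurableSpace.comap B inferInstance) hB.comap_le C D μ)
    {φ : T × V → S} (hφ : Measurable φ) {π : S → T} (hπ : Measurable π)
    (hπφ : ∀ p, π (φ p) = p.1) :
    μ.map (fun ω ↦ φ (B ω, D ω)) ⊗ₘ (condDistrib C B μ).comap π hπ
      = μ.map (fun ω ↦ (φ (B ω, D ω), C ω)) := by
  have h := (condIndepFun_iff_condDistrib_prod_ae_eq_prodMkRight hC hD hB).1 h_indep.symm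
  have h_map : μ.map (fun ω ↦ φ (B ω, D ω)) = (μ.map (fun ω ↦ (B ω, D ω))).map φ := by
    rw [Measure.map_map hφ (by fun_prop)]
    rfl
  have h_comap : ((condDistrib C B μ).comap π hπ).comap φ hφ
      = (condDistrib C B μ).prodMkRight V := by
    ext1 p
    simp [hπφ]
  rw [h_map, ← compProd_comap_map _ hφ, h_comap, ← Measure.compProd_congr h,
    compProd_map_condDistrib hC.aemeasurable, Measure.map_map (by fun_prop) (by fun_prop)]
  rfl

lemma compProd_condDistrib_pastPresent
    [StandardBorelSpace Ω]
    [StandardBorelSpace E] [Nonempty E] [StandardBorelSpace F] [Nonempty F]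
    (μ : Measure Ω) [IsProbabilityMeasure μ]
    (n : ℕ) (X : ℕ → Ω → E) (Y : ℕ → Ω → F)
    (hX : ∀ i, Measurable (X i)) (hY : ∀ i, Measurable (Y i))
    (hna : ∀ i < n, CondIndepFun
      (MeasurableSpace.comap
        (fun ω => (pastPresent X i ω, strictPast Y i ω)) inferInstance)
      (by apply Measurable.comap_le; fun_prop)
      (Y i) (future X i n) μ) (i : ℕ) (hi : i ≤ n)
    {π : (Fin (n + 1) → E) × (Fin i → F) → (Fin (i + 1) → E) × (Fin i → F)}
    (hπ : Measurable π)
    (hπ_eq : π = fun p ↦ (fun j ↦ p.1 ⟨j, by omega⟩, p.2)) :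
    μ.map (fun ω ↦ (pastPresent X n ω, strictPast Y i ω)) ⊗ₘ
        (condDistrib (Y i) (fun ω ↦ (pastPresent X i ω, strictPast Y i ω)) μ).comap π hπ
      = μ.map (fun ω ↦ ((pastPresent X n ω, strictPast Y i ω), Y i ω)) := by
  rcases hi.eq_or_lt with rfl | hlt
  · have hπ_id : π = id := hπ_eq
    subst hπ_id
    rw [Kernel.comap_id, compProd_map_condDistrib (hY i).aemeasurable]
  · let φ : ((Fin (i + 1) → E) × (Fin i → F)) × (Fin (n - i) → E) →
        (Fin (n + 1) → E) × (Fin i → F) :=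
      fun p ↦ (fun j ↦ if h : (j : ℕ) < i + 1 then p.1.1 ⟨j, h⟩
        else p.2 ⟨j - (i + 1), by omega⟩, p.1.2)
    have hφ : Measurable φ := by
      refine Measurable.prodMk (measurable_pi_iff.2 fun j ↦ ?_) (by fun_prop)
      by_cases h : (j : ℕ) < i + 1
      · simp only [h, dite_true]
        fun_prop
      · simp only [h, dite_false]
        fun_prop
    have hπφ (p) : π (φ p) = p.1 := by
      rw [hπ_eq]
      refine Prod.ext (funext fun j ↦ ?_) rfl
      simp [φ, j.2]
    have h_glue (ω : Ω) : φ ((pastPresent X i ω, strictPast Y i ω), future X i n ω)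
        = (pastPresent X n ω, strictPast Y i ω) := by
      refine Prod.ext (funext fun j ↦ ?_) rfl
      by_cases h : (j : ℕ) < i + 1
      · simp [φ, h]
      · simp only [φ, h, dite_false]
        exact congrArg (X · ω) (by dsimp only; omega)
    have h := compProd_condDistrib_comap_of_condIndepFun μ
      (B := fun ω ↦ (pastPresent X i ω, strictPast Y i ω)) (by fun_prop) (hY i)
      (D := future X i n) (by fun_prop) (hna i hlt) hφ hπ hπφ
    simpa only [h_glue] using h

lemma directedInformation_succ
    [StandardBorelSpace Ω]
    [StandardBorelSpace E] [Nonempty E] [StandardBorelSpace F] [Nonempty F]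
    (μ : Measure Ω) [IsProbabilityMeasure μ]
    (n : ℕ) (X : ℕ → Ω → E) (Y : ℕ → Ω → F)
    (hX : ∀ i, Measurable (X i)) (hY : ∀ i, Measurable (Y i))
    (hna : ∀ i < n, CondIndepFun
      (MeasurableSpace.comap
        (fun ω => (pastPresent X i ω, strictPast Y i ω)) inferInstance)
      (by apply Measurable.comap_le; fun_prop)
      (Y i) (future X i n) μ) (i : ℕ) (hi : i ≤ n) :
    InformationTheory.klDiv (μ.map (fun ω ↦ (pastPresent X n ω, strictPast Y (i + 1) ω)))
        ((μ.map (pastPresent X n)).prod (μ.map (strictPast Y (i + 1))))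
      = InformationTheory.klDiv (μ.map (fun ω ↦ (pastPresent X n ω, strictPast Y i ω)))
          ((μ.map (pastPresent X n)).prod (μ.map (strictPast Y i)))
        + ∫⁻ ω, InformationTheory.klDiv
            (condDistrib (Y i) (fun ω' ↦ (pastPresent X i ω', strictPast Y i ω')) μ
              (pastPresent X i ω, strictPast Y i ω))
            (condDistrib (Y i) (strictPast Y i) μ (strictPast Y i ω)) ∂μ := by
  have hXm : Measurable (pastPresent X n) := by fun_prop
  have hYm : Measurable (strictPast Y i) := by fun_prop
  let π : (Fin (n + 1) → E) × (Fin i → F) → (Fin (i + 1) → E) × (Fin i → F) :=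
    fun p ↦ (fun j ↦ p.1 ⟨j, by omega⟩, p.2)
  have hπ : Measurable π := by fun_prop
  have h_chain := klDiv_map_prod_add μ hXm hYm (hY i) _
    (compProd_condDistrib_pastPresent μ n X Y hX hY hna i hi hπ rfl)
  let snoc : (Fin i → F) × F → (Fin (i + 1) → F) :=
    fun p j ↦ if h : (j : ℕ) < i then p.1 ⟨j, h⟩ else p.2
  have h_snoc : Measurable snoc := by
    refine measurable_pi_iff.2 fun j ↦ ?_
    by_cases h : (j : ℕ) < i
    · simp only [snoc, h, dite_true]
      fun_prop
    · simp only [snoc, h, dite_false]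
      fun_prop
  have h_glue (ω : Ω) : snoc (strictPast Y i ω, Y i ω) = strictPast Y (i + 1) ω := by
    funext j
    by_cases h : (j : ℕ) < i
    · simp [snoc, h]
    · have hj : (j : ℕ) = i := by omega
      simp [snoc, strictPast, hj]
  let g : (Fin (n + 1) → E) × ((Fin i → F) × F) → (Fin (n + 1) → E) × (Fin (i + 1) → F) :=
    Prod.map id snoc
  let g' : (Fin (n + 1) → E) × (Fin (i + 1) → F) → (Fin (n + 1) → E) × ((Fin i → F) × F) :=
    fun p ↦ (p.1, (fun j ↦ p.2 j.castSucc, p.2 (Fin.last i)))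
  have hg : Measurable g := by fun_prop
  have hg' : Measurable g' := by fun_prop
  have hgg' : Function.LeftInverse g' g := by
    rintro ⟨x, y, z⟩
    simp [g, g', snoc]
  have : IsProbabilityMeasure (μ.map (pastPresent X n)) :=
    Measure.isProbabilityMeasure_map hXm.aemeasurable
  have : IsProbabilityMeasure (μ.map (fun ω ↦ (strictPast Y i ω, Y i ω))) :=
    Measure.isProbabilityMeasure_map (by fun_prop)
  have h_joint : μ.map (fun ω ↦ (pastPresent X n ω, strictPast Y (i + 1) ω))
      = (μ.map (fun ω ↦ (pastPresent X n ω, (strictPast Y i ω, Y i ω)))).map g := by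
    rw [Measure.map_map hg (by fun_prop)]
    simp only [Function.comp_def, g, Prod.map_apply, id, h_glue]
  have h_prod : (μ.map (pastPresent X n)).prod (μ.map (strictPast Y (i + 1)))
      = ((μ.map (pastPresent X n)).prod
          (μ.map (fun ω ↦ (strictPast Y i ω, Y i ω)))).map g := by
    rw [← Measure.map_prod_map _ _ measurable_id h_snoc, Measure.map_id,
      Measure.map_map h_snoc (by fun_prop)]
    simp only [Function.comp_def, h_glue]
  rw [h_joint, h_prod, InformationTheory.klDiv_map_eq_of_leftInverse _ _ hg hg' hgg', h_chain]
  rfl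

/-- Chain rule for directed information: under the nonanticipative factorization
(the Markov chains `Y_i ⟂ (X_{i+1},…,X_n) | (X^i, Y^{i-1})`), the directed information
`D(μ_{0,n} ⊗ Q⃗_{0,n} ‖ μ_{0,n} × ν_{0,n})` equals the sum over `i = 0,…,n` of the
expected conditional relative entropies
`E[ D( q_i(·; Y^{i-1}, X^i) ‖ ν_i(·; Y^{i-1}) ) ]`, where `q_i` is the conditional
distribution of `Y_i` given `(X^i, Y^{i-1})` and `ν_i` that of `Y_i` given `Y^{i-1}`. -/
theorem directed_information_chain_rule
    [StandardBorelSpace Ω] [Nonempty Ω]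
    [StandardBorelSpace E] [Nonempty E] [StandardBorelSpace F] [Nonempty F]
    (μ : Measure Ω) [IsProbabilityMeasure μ]
    (n : ℕ) (X : ℕ → Ω → E) (Y : ℕ → Ω → F)
    (hX : ∀ i, Measurable (X i)) (hY : ∀ i, Measurable (Y i))
    (hna : ∀ i < n, CondIndepFun
      (MeasurableSpace.comap
        (fun ω => (pastPresent X i ω, strictPast Y i ω)) inferInstance)
      (by apply Measurable.comap_le; fun_prop)
      (Y i) (future X i n) μ)
    (hfin : klDiv (μ.map (fun ω => (pastPresent X n ω, pastPresent Y n ω)))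
        ((μ.map (pastPresent X n)).prod (μ.map (pastPresent Y n))) ≠ ⊤) :
    klDiv (μ.map (fun ω => (pastPresent X n ω, pastPresent Y n ω)))
        ((μ.map (pastPresent X n)).prod (μ.map (pastPresent Y n)))
      = ∑ i ∈ Finset.range (n + 1),
          ∫⁻ ω, klDiv
            (condDistrib (Y i) (fun ω' => (pastPresent X i ω', strictPast Y i ω')) μ
              (pastPresent X i ω, strictPast Y i ω))
            (condDistrib (Y i) (strictPast Y i) μ (strictPast Y i ω)) ∂μ := by
  have hXm (i : ℕ) : Measurable (pastPresent X i) := by fun_prop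
  have hYm (i : ℕ) : Measurable (strictPast Y i) := by fun_prop
  have h_step (i : ℕ) (hi : i ≤ n) := directedInformation_succ μ n X Y hX hY hna i hi
  have h_sum (m : ℕ) (hm : m ≤ n + 1) :
      InformationTheory.klDiv (μ.map (fun ω => (pastPresent X n ω, strictPast Y m ω)))
        ((μ.map (pastPresent X n)).prod (μ.map (strictPast Y m)))
      = ∑ i ∈ Finset.range m, ∫⁻ ω, klDiv
            (condDistrib (Y i) (fun ω' => (pastPresent X i ω', strictPast Y i ω')) μ
              (pastPresent X i ω, strictPast Y i ω))
            (condDistrib (Y i) (strictPast Y i) μ (strictPast Y i ω)) ∂μ := by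
    induction m with
    | zero =>
      have h_const : strictPast Y 0 = fun _ ↦ Fin.elim0 := by
        ext ω j
        exact j.elim0
      have : IsProbabilityMeasure (μ.map (pastPresent X n)) :=
        Measure.isProbabilityMeasure_map (hXm n).aemeasurable
      have h_eq : μ.map (fun ω => (pastPresent X n ω, strictPast Y 0 ω))
          = (μ.map (pastPresent X n)).prod (μ.map (strictPast Y 0)) := by
        rw [h_const, Measure.map_const, measure_univ, one_smul, Measure.prod_dirac,
          Measure.map_map (by fun_prop) (hXm n)]
        rfl
      rw [h_eq]
      simp
    | succ m ih =>
      rw [Finset.sum_range_succ, ← ih (by omega), h_step m (by omega)]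
      simp_rw [klDiv_eq_informationTheory_klDiv]
  have : IsProbabilityMeasure (μ.map (fun ω => (pastPresent X n ω, pastPresent Y n ω))) :=
    Measure.isProbabilityMeasure_map (by fun_prop)
  have : IsProbabilityMeasure (μ.map (pastPresent X n)) :=
    Measure.isProbabilityMeasure_map (hXm n).aemeasurable
  have : IsProbabilityMeasure (μ.map (pastPresent Y n)) :=
    Measure.isProbabilityMeasure_map (hYm (n + 1)).aemeasurable
  rw [klDiv_eq_informationTheory_klDiv]
  exact h_sum (n + 1) le_rfl

end
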